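/- Let φ : ℂ[P₁₁₁,…,P₂₂₂] → ℂ[ζ,γ₁₂,γ₁₃,γ₂₃,a₁,a₂,b₁,b₂,c₁,c₂] be the ℂ-algebra homomorphism defined on the variables by φ(P_{ijk}) = ζ·γ₁₂^{δ(i=j)}·γ₁₃^{δ(i=k)}·γ₂₃^{δ(j=k)}·aᵢbⱼc_k for i,j,k ∈ {1,2} (so in particular φ(P_{iii}) = ζγ₁₂γ₁₃γ₂₃aᵢbᵢcᵢ, while triples with pairwise distinct indices do not occur when n=2 except none, and triples with exactly two equal indices get the corresponding single γ factor). Then ker φ is the principal ideal generated by the quartic binomial P₁₁₁P₁₂₂P₂₁₂P₂₂₁ − P₁₁₂P₁₂₁P₂₁₁P₂₂₂. -/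

import Mathlib

open MvPolynomial

/-- Parameters of the pairwise quasi-independence model `p-qI₂`:
ζ, γ₁₂, γ₁₃, γ₂₃, a₁, a₂, b₁, b₂, c₁, c₂. -/
inductive Param : Type
  | zeta : Param
  | g12 : Param
  | g13 : Param
  | g23 : Param
  | a : Fin 2 → Param
  | b : Fin 2 → Param
  | c : Fin 2 → Param

/-- The monomial parametrization map of the model `p-qI₂`:
`P_{ijk} ↦ ζ · γ₁₂^{δ(i=j)} · γ₁₃^{δ(i=k)} · γ₂₃^{δ(j=k)} · aᵢ bⱼ c_k`.
Indices in `Fin 2`: `0` stands for `1` and `1` stands for `2`. -/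
noncomputable def phi : MvPolynomial (Fin 2 × Fin 2 × Fin 2) ℂ →ₐ[ℂ] MvPolynomial Param ℂ :=
  aeval fun v : Fin 2 × Fin 2 × Fin 2 =>
    X Param.zeta *
      (if v.1 = v.2.1 then X Param.g12 else 1) *
      (if v.1 = v.2.2 then X Param.g13 else 1) *
      (if v.2.1 = v.2.2 then X Param.g23 else 1) *
      X (Param.a v.1) * X (Param.b v.2.1) * X (Param.c v.2.2)

/-- exponent vector of the image of a variable -/
noncomputable def wt (v : Fin 2 × Fin 2 × Fin 2) : Param →₀ ℕ :=
  Finsupp.single Param.zeta 1 +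
    (if v.1 = v.2.1 then Finsupp.single Param.g12 1 else 0) +
    (if v.1 = v.2.2 then Finsupp.single Param.g13 1 else 0) +
    (if v.2.1 = v.2.2 then Finsupp.single Param.g23 1 else 0) +
    Finsupp.single (Param.a v.1) 1 + Finsupp.single (Param.b v.2.1) 1 +
    Finsupp.single (Param.c v.2.2) 1

/-- exponent map -/
noncomputable def ex (m : (Fin 2 × Fin 2 × Fin 2) →₀ ℕ) : Param →₀ ℕ :=
  ∑ v, m v • wt v

lemma phi_X (v : Fin 2 × Fin 2 × Fin 2) : phi (X v) = monomial (wt v) 1 := by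
  have key : ∀ (P : Prop) [Decidable P] (q : Param), (if P then X q else 1 : MvPolynomial Param ℂ)
      = monomial (if P then Finsupp.single q 1 else 0) 1 := by
    intro P _ q
    split_ifs
    · rfl
    · simp
  simp only [phi, aeval_X, key, wt]
  simp only [X, monomial_mul, mul_one]

lemma monomial_eq_prod8 (m : (Fin 2 × Fin 2 × Fin 2) →₀ ℕ) :
    (monomial m (1:ℂ)) = ∏ v, X v ^ m v := by
  rw [monomial_eq, Finsupp.prod_fintype _ _ (by simp)]; simp

lemma phi_monomial (m : (Fin 2 × Fin 2 × Fin 2) →₀ ℕ) :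
    phi (monomial m 1) = monomial (ex m) 1 := by
  rw [monomial_eq_prod8, map_prod, ex, monomial_sum_one]
  refine Finset.prod_congr rfl fun v _ => ?_
  rw [map_pow, phi_X, monomial_pow, one_pow]

/-- the ideal -/
noncomputable def II : Ideal (MvPolynomial (Fin 2 × Fin 2 × Fin 2) ℂ) :=
  Ideal.span
        ({X (0, 0, 0) * X (0, 1, 1) * X (1, 0, 1) * X (1, 1, 0) -
            X (0, 0, 1) * X (0, 1, 0) * X (1, 0, 0) * X (1, 1, 1)} :
          Set (MvPolynomial (Fin 2 × Fin 2 × Fin 2) ℂ))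

lemma mem_aux (m n : (Fin 2 × Fin 2 × Fin 2) →₀ ℕ) (h : ex m = ex n)
    (hle : n (0,0,0) ≤ m (0,0,0)) : monomial m (1:ℂ) - monomial n 1 ∈ II := by
  have hz := DFunLike.congr_fun h Param.zeta
  have h12 := DFunLike.congr_fun h Param.g12
  have h13 := DFunLike.congr_fun h Param.g13
  have h23 := DFunLike.congr_fun h Param.g23
  have ha := DFunLike.congr_fun h (Param.a 0)
  have hb := DFunLike.congr_fun h (Param.b 0)
  have hc := DFunLike.congr_fun h (Param.c 0)
  classical
  simp [ex, wt, Fintype.sum_prod_type, Finsupp.single_apply] at hz h12 h13 h23 ha hb hc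
  obtain ⟨k, hk⟩ := Nat.exists_eq_add_of_le hle
  have e1 : m (0,1,1) = n (0,1,1) + k := by omega
  have e2 : m (1,0,1) = n (1,0,1) + k := by omega
  have e3 : m (1,1,0) = n (1,1,0) + k := by omega
  have e4 : n (0,0,1) = m (0,0,1) + k := by omega
  have e5 : n (0,1,0) = m (0,1,0) + k := by omega
  have e6 : n (1,0,0) = m (1,0,0) + k := by omega
  have e7 : n (1,1,1) = m (1,1,1) + k := by omega
  rw [II, Ideal.mem_span_singleton]
  refine (sub_dvd_pow_sub_pow _ _ k).trans ?_
  rw [monomial_eq_prod8, monomial_eq_prod8]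
  simp only [Fintype.prod_prod_type, Fin.prod_univ_two]
  rw [hk, e1, e2, e3, e4, e5, e6, e7]
  refine ⟨X (0,0,0) ^ n (0,0,0) * X (0,1,1) ^ n (0,1,1) * X (1,0,1) ^ n (1,0,1) *
    X (1,1,0) ^ n (1,1,0) * X (0,0,1) ^ m (0,0,1) * X (0,1,0) ^ m (0,1,0) *
    X (1,0,0) ^ m (1,0,0) * X (1,1,1) ^ m (1,1,1), ?_⟩
  ring

lemma mem_of_ex (m n : (Fin 2 × Fin 2 × Fin 2) →₀ ℕ) (h : ex m = ex n) :
    monomial m (1:ℂ) - monomial n 1 ∈ II := by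
  rcases le_total (n (0,0,0)) (m (0,0,0)) with h1 | h1
  · exact mem_aux m n h h1
  · rw [← neg_sub]
    exact II.neg_mem (mem_aux n m h.symm h1)

/-- a section of `phi` modulo the ideal -/
noncomputable def sec : MvPolynomial Param ℂ →ₗ[ℂ]
    (MvPolynomial (Fin 2 × Fin 2 × Fin 2) ℂ ⧸ II) :=
  (basisMonomials Param ℂ).constr ℂ
    fun d => Ideal.Quotient.mkₐ ℂ II (monomial (Function.invFun ex d) 1)

lemma sec_phi : sec ∘ₗ phi.toLinearMap = (Ideal.Quotient.mkₐ ℂ II).toLinearMap := by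
  refine (basisMonomials _ ℂ).ext fun m => ?_
  have h1 : sec (monomial (ex m) 1) =
      Ideal.Quotient.mkₐ ℂ II (monomial (Function.invFun ex (ex m)) 1) := by
    have := (basisMonomials Param ℂ).constr_basis ℂ
      (fun d => Ideal.Quotient.mkₐ ℂ II (monomial (Function.invFun ex d) 1)) (ex m)
    rwa [coe_basisMonomials] at this
  simp only [coe_basisMonomials, LinearMap.comp_apply, AlgHom.toLinearMap_apply]
  rw [phi_monomial, h1]
  exact Ideal.Quotient.eq.2 (mem_of_ex _ _ (Function.invFun_eq ⟨m, rfl⟩))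

/-- The kernel of the parametrization map of `p-qI₂` is the principal ideal generated by
the quartic binomial `P₁₁₁P₁₂₂P₂₁₂P₂₂₁ − P₁₁₂P₁₂₁P₂₁₁P₂₂₂`. -/
theorem pqI2_invariants :
    RingHom.ker phi =
      Ideal.span
        ({X (0, 0, 0) * X (0, 1, 1) * X (1, 0, 1) * X (1, 1, 0) -
            X (0, 0, 1) * X (0, 1, 0) * X (1, 0, 0) * X (1, 1, 1)} :
          Set (MvPolynomial (Fin 2 × Fin 2 × Fin 2) ℂ)) := by
  change RingHom.ker phi = II
  apply le_antisymm
  · intro f hf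
    have h := LinearMap.congr_fun sec_phi f
    simp only [LinearMap.comp_apply, AlgHom.toLinearMap_apply] at h
    rw [(RingHom.mem_ker).1 hf, map_zero] at h
    exact Ideal.Quotient.eq_zero_iff_mem.1 h.symm
  · rw [II, Ideal.span_le, Set.singleton_subset_iff]
    change _ ∈ RingHom.ker phi
    rw [RingHom.mem_ker]
    simp [phi]
    ring
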